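/- arXiv:1408.1000 — 2 statements merged into one kernel-verified Lean document; each statement's English description precedes it below -/
import Mathlib

section
/- For every positive integer d and every real α > 0 that is not an integer, there exist vectors x, y ∈ ℝ^d with strictly positive entries such that Σ_{i=1}^d x_i^r = Σ_{i=1}^d y_i^r for every integer r with 1 ≤ r ≤ d−1, but Σ_{i=1}^d x_i^d ≠ Σ_{i=1}^d y_i^d and Σ_{i=1}^d x_i^α ≠ Σ_{i=1}^d y_i^α. -/
open Real

theorem exists_eq_zero_of_strictMono_zeros (n : ℕ) : ∀ (F : ℕ → ℝ → ℝ) (t : ℕ → ℝ),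
    (∀ k x, 0 < x → HasDerivAt (F k) (F (k + 1) x) x) → (∀ i ≤ n, 0 < t i) →
    (∀ i < n, t i < t (i + 1)) → (∀ i ≤ n, F 0 (t i) = 0) → ∃ ξ, 0 < ξ ∧ F n ξ = 0 := by
  induction n with
  | zero => exact fun F t _ ht _ hz => ⟨t 0, ht 0 le_rfl, hz 0 le_rfl⟩
  | succ n ih =>
    intro F t hF ht hmono hz
    have rolle : ∀ i, ∃ ξ, i ≤ n → t i < ξ ∧ ξ < t (i + 1) ∧ F 1 ξ = 0 := by
      intro i
      by_cases hi : i ≤ n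
      · have hpos : ∀ x, t i ≤ x → 0 < x := fun x hx => (ht i (by lia)).trans_le hx
        obtain ⟨ξ, hξ, h0⟩ := exists_hasDerivAt_eq_zero (hmono i (by lia))
          (fun x hx => (hF 0 x (hpos x hx.1)).continuousAt.continuousWithinAt)
          ((hz i (by lia)).trans (hz (i + 1) (by lia)).symm)
          (fun x hx => hF 0 x (hpos x hx.1.le))
        exact ⟨ξ, fun _ => ⟨hξ.1, hξ.2, h0⟩⟩
      · exact ⟨0, fun h => absurd h hi⟩
    choose ξ hξ using rolle
    exact ih (fun k => F (k + 1)) ξ (fun k x hx => hF (k + 1) x hx)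
      (fun i hi => (ht i (by lia)).trans (hξ i hi).1)
      (fun i hi => (hξ i hi.le).2.1.trans (hξ (i + 1) hi).1)
      (fun i hi => (hξ i hi).2.2)

theorem descPochhammer_eval_ne_zero (β : ℝ) (n : ℕ) (hβ : ∀ m < n, β ≠ m) :
    (descPochhammer ℝ n).eval β ≠ 0 := by
  induction n with
  | zero => simp
  | succ n ih =>
    rw [descPochhammer_succ_eval]
    exact mul_ne_zero (ih fun m hm => hβ m (by lia)) (sub_ne_zero.2 (hβ n (by lia)))

/-- A real power that is not a monomial of degree less than `n` agrees with a polynomial of degree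
less than `n` in at most `n` positive points. -/
theorem not_forall_rpow_eq_eval (β : ℝ) (n : ℕ) (hβ : ∀ m < n, β ≠ m) (p : Polynomial ℝ)
    (hp : p.degree < n) (t : ℕ → ℝ) (ht : ∀ i ≤ n, 0 < t i) (hmono : ∀ i < n, t i < t (i + 1)) :
    ¬ ∀ i ≤ n, t i ^ β = p.eval (t i) := by
  intro h
  obtain ⟨ξ, hξ, h0⟩ := exists_eq_zero_of_strictMono_zeros n
    (fun k x => (descPochhammer ℝ k).eval β * x ^ (β - k) -
      (Polynomial.derivative^[k] p).eval x) t
    (by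
      intro k x hx
      have h1 := (Real.hasDerivAt_rpow_const (p := β - k) (Or.inl hx.ne')).const_mul
        ((descPochhammer ℝ k).eval β)
      have h2 := (Polynomial.derivative^[k] p).hasDerivAt x
      refine (h1.sub h2).congr_deriv ?_
      rw [descPochhammer_succ_eval, Function.iterate_succ_apply']
      push_cast
      rw [sub_sub, mul_assoc])
    ht hmono (fun i hi => by simp [h i hi])
  have hd : Polynomial.derivative^[n] p = 0 := by
    by_cases hp0 : p = 0
    · simp [hp0]
    · exact Polynomial.iterate_derivative_eq_zero
        ((Polynomial.natDegree_lt_iff_degree_lt hp0).2 hp)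
  simp only [hd, Polynomial.eval_zero, sub_zero] at h0
  exact mul_ne_zero (descPochhammer_eval_ne_zero β n hβ) (Real.rpow_pos_of_pos hξ _).ne' h0

theorem sum_cos_int_mul_eq_zero (d : ℕ) (m : ℤ) (hm : m ≠ 0) (hmd : |m| < d) (θ : ℝ) :
    ∑ i ∈ Finset.range d, cos (m * (2 * i * π / d + θ)) = 0 := by
  have hd : (0 : ℝ) < d := by exact_mod_cast (abs_nonneg m).trans_lt hmd
  have hs : sin (m * π / d) ≠ 0 := by
    intro h
    obtain ⟨k, hk⟩ := Real.sin_eq_zero_iff.1 h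
    have h1 : (k * d : ℝ) = m := by
      field_simp at hk
      exact hk
    have h2 : k * d = m := by exact_mod_cast h1
    exact hm (Int.eq_zero_of_abs_lt_dvd (Dvd.intro_left k h2) hmd)
  have key : 2 * sin (m * π / d) * ∑ i ∈ Finset.range d, cos (m * (2 * i * π / d + θ)) =
      ∑ i ∈ Finset.range d, (sin (m * ((2 * (i + 1 : ℕ) - 1) * π / d + θ)) -
        sin (m * ((2 * i - 1) * π / d + θ))) := by
    rw [Finset.mul_sum]
    refine Finset.sum_congr rfl fun i _ => ?_
    rw [Real.sin_sub_sin]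
    congr 2
    · congr 1
      push_cast
      ring_nf
    · push_cast
      ring_nf
  rw [Finset.sum_range_sub (fun i : ℕ => sin (m * ((2 * i - 1) * π / d + θ))),
    show (m : ℝ) * ((2 * (d : ℕ) - 1) * π / d + θ) =
      m * ((2 * (0 : ℕ) - 1) * π / d + θ) + m * (2 * π) by
      push_cast
      field_simp
      ring,
    Real.sin_add_int_mul_two_pi, sub_self] at key
  exact (mul_eq_zero.1 key).resolve_left (mul_ne_zero two_ne_zero hs)

theorem sum_pow_mul_cos_eq (d : ℕ) (θ : ℝ) (r : ℕ) : ∀ m : ℤ, r + |m| < d →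
    ∑ i ∈ Finset.range d, (2 + cos (2 * i * π / d + θ)) ^ r * cos (m * (2 * i * π / d + θ)) =
    ∑ i ∈ Finset.range d, (2 + cos (2 * i * π / d)) ^ r * cos (m * (2 * i * π / d)) := by
  induction r with
  | zero =>
    intro m hm
    by_cases h0 : m = 0
    · simp [h0]
    · have h1 := sum_cos_int_mul_eq_zero d m h0 (by simpa using hm)
      simpa [h1 θ] using (h1 0).symm
  | succ r ih =>
    intro m hm
    have expand : ∀ φ : ℝ, (2 + cos φ) ^ (r + 1) * cos (m * φ) =
        2 * ((2 + cos φ) ^ r * cos (m * φ)) +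
        ((2 + cos φ) ^ r * cos ((m + 1 : ℤ) * φ) +
          (2 + cos φ) ^ r * cos ((m - 1 : ℤ) * φ)) / 2 := by
      intro φ
      push_cast
      rw [add_mul, sub_mul, one_mul, cos_add, cos_sub]
      ring
    simp only [expand, Finset.sum_add_distrib, ← Finset.sum_div, ← Finset.mul_sum]
    push_cast at hm
    have h1 := abs_add_le m 1
    have h2 := abs_sub m 1
    rw [abs_one] at h1 h2
    rw [ih m (by lia), ih (m + 1) (by lia), ih (m - 1) (by lia)]

theorem sum_pow_two_add_cos_eq (d r : ℕ) (hr : r < d) (θ : ℝ) :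
    ∑ i ∈ Finset.range d, (2 + cos (2 * i * π / d + θ)) ^ r =
    ∑ i ∈ Finset.range d, (2 + cos (2 * i * π / d)) ^ r := by
  simpa using sum_pow_mul_cos_eq d θ r 0 (by simpa using hr)

theorem sum_eval_two_add_cos_eq (d : ℕ) (p : Polynomial ℝ) (hp : p.degree < d) (θ : ℝ) :
    ∑ i ∈ Finset.range d, p.eval (2 + cos (2 * i * π / d + θ)) =
    ∑ i ∈ Finset.range d, p.eval (2 + cos (2 * i * π / d)) := by
  by_cases hp0 : p = 0
  · simp [hp0]
  have hn := (Polynomial.natDegree_lt_iff_degree_lt hp0).2 hp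
  simp only [Polynomial.eval_eq_sum_range' hn]
  refine Finset.sum_comm.trans
    (Eq.trans (Finset.sum_congr rfl fun r hr => ?_) Finset.sum_comm)
  rw [← Finset.mul_sum, ← Finset.mul_sum, sum_pow_two_add_cos_eq d r (Finset.mem_range.1 hr)]

theorem two_add_cos_pos (θ : ℝ) : 0 < 2 + cos θ := by linarith [neg_one_le_cos θ]

theorem sum_rpow_two_add_cos_ne (d : ℕ) (hd : 0 < d) (β : ℝ) (hβ : ∀ m < d, β ≠ m) :
    ∑ i ∈ Finset.range d, (2 + cos (2 * i * π / d)) ^ β ≠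
    ∑ i ∈ Finset.range d, (2 + cos (2 * i * π / d + π / d)) ^ β := by
  intro heq
  have hd' : (0 : ℝ) < d := by exact_mod_cast hd
  let t : ℕ → ℝ := fun j => 2 - cos (j * π / d)
  have hmono : ∀ i < d, ∀ j ≤ d, i < j → t i < t j := by
    intro i _ j hj hij
    have hj' : (j : ℝ) ≤ d := by exact_mod_cast hj
    have hij' : (i : ℝ) < j := by exact_mod_cast hij
    refine sub_lt_sub_left (cos_lt_cos_of_nonneg_of_le_pi (by positivity) ?_ ?_) _
    · rw [div_le_iff₀ hd']
      nlinarith [pi_pos]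
    · gcongr
  have hinj : Set.InjOn t (Finset.range d) := by
    intro i hi j hj h
    simp only [Finset.coe_range, Set.mem_Iio] at hi hj
    rcases lt_trichotomy i j with hij | hij | hij
    · exact absurd h (hmono i hi j hj.le hij).ne
    · exact hij
    · exact absurd h (hmono j hj i hi.le hij).ne'
  let p := Lagrange.interpolate (Finset.range d) t (fun j => t j ^ β)
  have hp : p.degree < d := by
    simpa only [Finset.card_range] using Lagrange.degree_interpolate_lt (fun j => t j ^ β) hinj
  have hnode : ∀ j < d, t j ^ β = p.eval (t j) := fun j hj =>
    (Lagrange.eval_interpolate_at_node (fun j => t j ^ β) hinj (Finset.mem_range.2 hj)).symm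
  have hcos : ∀ k : ℕ, 0 < k → k < 2 * d →
      (2 + cos (k * π / d)) ^ β = p.eval (2 + cos (k * π / d)) := by
    intro k hk hk'
    have hk_node : 2 + cos (k * π / d) = t ((d : ℤ) - k).natAbs := by
      simp only [t, Nat.cast_natAbs, Int.cast_abs]
      push_cast
      rw [show |(d : ℝ) - k| * π / d = |π - k * π / d| by
        rw [show π - k * π / d = (d - k) * (π / d) by field_simp, abs_mul,
          abs_of_pos (div_pos pi_pos hd'), mul_div_assoc], cos_abs, cos_pi_sub]
      ring
    rw [hk_node]
    exact hnode _ (by lia)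
  have hx : ∀ i < d, i ≠ 0 → (2 + cos (2 * i * π / d)) ^ β =
      p.eval (2 + cos (2 * i * π / d)) := by
    intro i hi hi0
    simpa using hcos (2 * i) (by lia) (by lia)
  have hy : ∀ i < d, (2 + cos (2 * i * π / d + π / d)) ^ β =
      p.eval (2 + cos (2 * i * π / d + π / d)) := by
    intro i hi
    have h := hcos (2 * i + 1) (by lia) (by lia)
    rw [show ((2 * i + 1 : ℕ) : ℝ) * π / d = 2 * i * π / d + π / d by push_cast; ring] at h
    exact h
  rw [Finset.sum_congr rfl fun i hi => hy i (Finset.mem_range.1 hi),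
    sum_eval_two_add_cos_eq d p hp, ← sub_eq_zero, ← Finset.sum_sub_distrib,
    Finset.sum_eq_single_of_mem 0 (Finset.mem_range.2 hd)
      fun i hi hi0 => sub_eq_zero.2 (hx i (Finset.mem_range.1 hi) hi0), sub_eq_zero] at heq
  refine not_forall_rpow_eq_eval β d hβ p hp t
    (fun i _ => by simpa [t] using (cos_le_one (i * π / d)).trans_lt one_lt_two)
    (fun i hi => hmono i hi (i + 1) hi i.lt_succ_self) fun i hi => ?_
  rcases hi.lt_or_eq with hi | rfl
  · exact hnode i hi
  · have ht : t i = 2 + cos (2 * (0 : ℕ) * π / i) := by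
      simp only [t]
      rw [mul_div_cancel_left₀ _ hd'.ne', cos_pi]
      simp
    rw [ht]
    exact heq

open Real

/-- For every positive integer `d` and noninteger real `α > 0`, there exist positive vectors
`x, y ∈ ℝ^d` whose power sums agree for all integer orders `1 ≤ r ≤ d - 1` but disagree
at order `d` and at order `α`. -/
theorem exists_matching_power_sums (d : ℕ) (hd : 0 < d)
    (α : ℝ) (hα : 0 < α) (hα' : ∀ m : ℕ, α ≠ m) :
    ∃ x y : Fin d → ℝ,
      (∀ i, 0 < x i) ∧ (∀ i, 0 < y i) ∧
      (∀ r : ℕ, 1 ≤ r → r ≤ d - 1 → ∑ i, x i ^ r = ∑ i, y i ^ r) ∧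
      (∑ i, x i ^ d ≠ ∑ i, y i ^ d) ∧
      (∑ i, x i ^ α ≠ ∑ i, y i ^ α) := by
  refine ⟨fun i => 2 + cos (2 * i * π / d), fun i => 2 + cos (2 * i * π / d + π / d),
    fun i => two_add_cos_pos _, fun i => two_add_cos_pos _, fun r _ hr => ?_, ?_, ?_⟩
  · rw [Fin.sum_univ_eq_sum_range (fun i : ℕ => (2 + cos (2 * i * π / d)) ^ r),
      Fin.sum_univ_eq_sum_range (fun i : ℕ => (2 + cos (2 * i * π / d + π / d)) ^ r)]
    exact (sum_pow_two_add_cos_eq d r (by lia) _).symm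
  · rw [Fin.sum_univ_eq_sum_range (fun i : ℕ => (2 + cos (2 * i * π / d)) ^ d),
      Fin.sum_univ_eq_sum_range (fun i : ℕ => (2 + cos (2 * i * π / d + π / d)) ^ d)]
    simpa only [rpow_natCast] using
      sum_rpow_two_add_cos_ne d hd d fun m hm => by exact_mod_cast hm.ne'
  · rw [Fin.sum_univ_eq_sum_range (fun i : ℕ => (2 + cos (2 * i * π / d)) ^ α),
      Fin.sum_univ_eq_sum_range (fun i : ℕ => (2 + cos (2 * i * π / d + π / d)) ^ α)]
    exact sum_rpow_two_add_cos_ne d hd α fun m _ => hα' m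
end

section
/- Let α > 1 be a real number that is not an integer, and fix 0 < ε < 1/2. Then for every η > 0 there exist δ > 0 and c > 0 such that for all sufficiently large k the following holds: if n ≤ c · k^{1−η}, then for every estimator f : X^n → ℝ there exists a probability distribution p over an alphabet X of k elements with P_{X^n ~ p^{⊗n}}( |H_α(p) − f(X_1, …, X_n)| > δ ) ≥ ε. In other words, S_α(k) grows polynomially in k with exponent at least 1 − η for every η > 0 (S_α(k) = Ω̃~(k)). -/
open Real

/-- `p` is a probability distribution on a finite alphabet. -/
def IsDist {X : Type*} [Fintype X] (p : X → ℝ) : Prop :=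
  (∀ x, 0 ≤ p x) ∧ ∑ x, p x = 1

/-- The Rényi entropy of order `α ≠ 1`. -/
noncomputable def renyiEntropy {X : Type*} [Fintype X] (α : ℝ) (p : X → ℝ) : ℝ :=
  (1 / (1 - α)) * Real.log (∑ x, p x ^ α)

open Classical in
/-- The probability, under `n` i.i.d. samples from `p`, of the event `E` on sample sequences. -/
noncomputable def probEvent {X : Type*} [Fintype X] {n : ℕ} (p : X → ℝ)
    (E : (Fin n → X) → Prop) : ℝ :=
  ∑ s : Fin n → X, if E s then ∏ i, p (s i) else 0

open Finset

theorem hasDerivAt_fwdDiff_iter_rpow (m : ℕ) (β a : ℝ) (ha : 0 < a) :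
    HasDerivAt ((fwdDiff (1 : ℝ))^[m] fun t : ℝ => t ^ β)
      (β * (fwdDiff (1 : ℝ))^[m] (fun t : ℝ => t ^ (β - 1)) a) a := by
  induction m generalizing a with
  | zero => simpa using Real.hasDerivAt_rpow_const (p := β) (Or.inl ha.ne')
  | succ m ih =>
    have h1 := ((ih (a + 1) (by linarith)).comp_add_const a 1).sub (ih a ha)
    simp only [Function.iterate_succ_apply', fwdDiff, mul_sub]
    exact h1

theorem fwdDiff_iter_rpow_ne_zero (m : ℕ) (β a : ℝ) (hβ : ∀ j : ℕ, β ≠ j) (ha : 0 < a) :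
    (fwdDiff (1 : ℝ))^[m] (fun t : ℝ => t ^ β) a ≠ 0 := by
  induction m generalizing β a with
  | zero => simpa using (Real.rpow_pos_of_pos ha β).ne'
  | succ m ih =>
    intro h0
    rw [Function.iterate_succ_apply', fwdDiff, sub_eq_zero] at h0
    have hd : ∀ t ∈ Set.Icc a (a + 1), HasDerivAt ((fwdDiff (1 : ℝ))^[m] fun t : ℝ => t ^ β)
        (β * (fwdDiff (1 : ℝ))^[m] (fun t : ℝ => t ^ (β - 1)) t) t := fun t ht =>
      hasDerivAt_fwdDiff_iter_rpow m β t (ha.trans_le ht.1)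
    obtain ⟨ξ, hξ, h⟩ := exists_hasDerivAt_eq_zero (lt_add_one a)
      (fun t ht => (hd t ht).continuousAt.continuousWithinAt) h0.symm
      (fun t ht => hd t (Set.Ioo_subset_Icc_self ht))
    rcases mul_eq_zero.1 h with h | h
    · exact hβ 0 (by simpa using h)
    · refine ih (β - 1) ξ (fun j hj => hβ (j + 1) ?_) (ha.trans hξ.1) h
      push_cast
      linarith

/-- Iterated forward differences split into two multisets of sampling nodes of equal size. -/
theorem exists_nodes_fwdDiff_iter (d : ℕ) :
    ∃ (m : ℕ) (x y : Fin m → ℝ), 0 < m ∧ (∀ i, 0 ≤ x i) ∧ (∀ i, 0 ≤ y i) ∧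
      ∀ (φ : ℝ → ℝ) (a : ℝ),
        ∑ i, φ (a + x i) - ∑ i, φ (a + y i) = (fwdDiff (1 : ℝ))^[d + 1] φ a := by
  induction d with
  | zero =>
    exact ⟨1, fun _ => 1, fun _ => 0, one_pos, by simp, by simp, fun φ a => by simp [fwdDiff]⟩
  | succ d ih =>
    obtain ⟨m, x, y, hm, hx, hy, h⟩ := ih
    refine ⟨m + m, Fin.append (fun i => 1 + x i) y, Fin.append (fun i => 1 + y i) x, by omega,
      ?_, ?_, fun φ a => ?_⟩
    · intro i
      refine Fin.addCases (fun j => ?_) (fun j => ?_) i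
      · simpa using add_nonneg zero_le_one (hx j)
      · rw [Fin.append_right]; exact hy j
    · intro i
      refine Fin.addCases (fun j => ?_) (fun j => ?_) i
      · simpa using add_nonneg zero_le_one (hy j)
      · rw [Fin.append_right]; exact hx j
    · rw [Function.iterate_succ_apply', fwdDiff, ← h φ a, ← h φ (a + 1)]
      simp only [Fin.sum_univ_add, Fin.append_left, Fin.append_right, add_assoc]
      ring

/-- Two distributions with the same power sums of integer orders up to `d`, but different power
sums of a noninteger order. -/
theorem exists_isDist_powerSum_eq (α : ℝ) (hα : ∀ j : ℕ, α ≠ j) (d : ℕ) (hd : 1 ≤ d) :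
    ∃ (m : ℕ) (x y : Fin m → ℝ), 0 < m ∧ (∀ i, 0 < x i) ∧ (∀ i, 0 < y i) ∧
      ∑ i, x i = 1 ∧ ∑ i, y i = 1 ∧
      (∀ t ≤ d, ∑ i, x i ^ t = ∑ i, y i ^ t) ∧ ∑ i, x i ^ α ≠ ∑ i, y i ^ α := by
  obtain ⟨m, x, y, hm, hx, hy, h⟩ := exists_nodes_fwdDiff_iter d
  have hx1 : ∀ i, 0 < 1 + x i := fun i => by linarith [hx i]
  have hy1 : ∀ i, 0 < 1 + y i := fun i => by linarith [hy i]
  have hpow : ∀ t ≤ d, ∑ i, (1 + x i) ^ t = ∑ i, (1 + y i) ^ t := fun t ht => by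
    have := h (fun z => z ^ t) 1
    rw [fwdDiff_iter_pow_eq_zero_of_lt (Nat.lt_succ_of_le ht)] at this
    simpa [sub_eq_zero] using this
  set N := ∑ i, (1 + x i) with hN
  have hNy : N = ∑ i, (1 + y i) := by simpa using hpow 1 hd
  have : Nonempty (Fin m) := ⟨⟨0, hm⟩⟩
  have hN0 : 0 < N := sum_pos (fun i _ => hx1 i) univ_nonempty
  refine ⟨m, fun i => (1 + x i) / N, fun i => (1 + y i) / N, hm,
    fun i => div_pos (hx1 i) hN0, fun i => div_pos (hy1 i) hN0, ?_, ?_, fun t ht => ?_, ?_⟩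
  · rw [← sum_div, ← hN, div_self hN0.ne']
  · rw [← sum_div, ← hNy, div_self hN0.ne']
  · simp only [div_pow]
    rw [← sum_div, ← sum_div, hpow t ht]
  · have hne := fwdDiff_iter_rpow_ne_zero (d + 1) α 1 hα one_pos
    rw [← h] at hne
    simp only [Real.div_rpow (hx1 _).le hN0.le, Real.div_rpow (hy1 _).le hN0.le]
    rw [← sum_div, ← sum_div, Ne, div_left_inj' (Real.rpow_pos_of_pos hN0 α).ne']
    exact sub_ne_zero.1 hne

section PermutationSums

variable {ι : Type*} [Fintype ι] [DecidableEq ι]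

theorem powerSum_mul_sum_perm (x : ι → ℝ) (a : ι → ℕ) (t : ℕ) :
    (∑ w, x w ^ t) * ∑ σ : Equiv.Perm ι, ∏ v, x (σ v) ^ a v =
      ∑ w, ∑ σ : Equiv.Perm ι, ∏ v, x (σ v) ^ (a + Pi.single w t : ι → ℕ) v := by
  rw [mul_sum, sum_comm]
  refine sum_congr rfl fun σ _ => ?_
  rw [← Equiv.sum_comp σ, sum_mul]
  refine sum_congr rfl fun w _ => ?_
  simp only [Pi.add_apply, pow_add, prod_mul_distrib]
  rw [mul_comm]
  congr 1
  rw [Fintype.prod_eq_single w]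
  · simp
  · intro v hv
    simp [hv]

theorem sum_perm_prod_pow_comp (x : ι → ℝ) (a : ι → ℕ) (τ : Equiv.Perm ι) :
    ∑ σ : Equiv.Perm ι, ∏ v, x (σ v) ^ a (τ v) = ∑ σ : Equiv.Perm ι, ∏ v, x (σ v) ^ a v := by
  rw [← Equiv.sum_comp (Equiv.mulRight τ)]
  refine sum_congr rfl fun σ _ => ?_
  exact Equiv.prod_comp τ fun v => x (σ v) ^ a v

/-- Symmetrized monomials of degree at most `d` are determined by the power sums of order at
most `d`. -/
theorem sum_perm_prod_pow_eq (x y : ι → ℝ) (d : ℕ)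
    (h : ∀ t ≤ d, ∑ i, x i ^ t = ∑ i, y i ^ t) (a : ι → ℕ) (ha : ∑ i, a i ≤ d) :
    ∑ σ : Equiv.Perm ι, ∏ v, x (σ v) ^ a v = ∑ σ : Equiv.Perm ι, ∏ v, y (σ v) ^ a v := by
  obtain ⟨r, hr⟩ : ∃ r, #{v | a v ≠ 0} = r := ⟨_, rfl⟩
  induction r using Nat.strong_induction_on generalizing a with
  | _ r ih =>
  by_cases hz : ∀ v, a v = 0
  · simp [hz]
  push Not at hz
  obtain ⟨v, hv⟩ := hz
  set a' : ι → ℕ := Function.update a v 0 with ha'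
  have hsplit : a' + Pi.single v (a v) = a := by
    ext w
    by_cases hw : w = v
    · subst hw; simp [ha']
    · simp [ha', hw]
  have hsum : ∀ w, ∑ i, (a' + Pi.single w (a v) : ι → ℕ) i = ∑ i, a i := fun w => by
    conv_rhs => rw [← hsplit]
    simp [sum_add_distrib]
  have hsub : ({w | a' w ≠ 0} : Finset ι) = ({w | a w ≠ 0} : Finset ι).erase v := by
    ext w
    by_cases hw : w = v
    · subst hw; simp [ha']
    · simp [ha', hw]
  have hcard : #{w | a' w ≠ 0} < r := by
    rw [hsub, ← hr]
    exact card_erase_lt_of_mem (by simpa using hv)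
  have hswap : ∀ (z : ι → ℝ) (w : ι), a' w = 0 →
      ∑ σ : Equiv.Perm ι, ∏ u, z (σ u) ^ (a' + Pi.single w (a v) : ι → ℕ) u =
        ∑ σ : Equiv.Perm ι, ∏ u, z (σ u) ^ a u := fun z w hw => by
    rw [← sum_perm_prod_pow_comp z a (Equiv.swap v w)]
    refine sum_congr rfl fun σ _ => prod_congr rfl fun u _ => congrArg _ ?_
    by_cases hwv : w = v
    · rw [hwv, hsplit, Equiv.swap_self, Equiv.refl_apply]
    · rw [ha', Function.update_of_ne hwv] at hw
      by_cases huv : u = v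
      · subst huv; simp [ha', hw, Ne.symm hwv]
      · by_cases huw : u = w
        · subst huw; simp [ha', hw, hwv]
        · simp [ha', huv, huw, Equiv.swap_apply_of_ne_of_ne huv huw]
  have hle : ∑ i, a' i ≤ d := by
    refine le_trans (sum_le_sum fun i _ => ?_) ha
    rw [← hsplit]; simp
  have hlt : a v ≤ d := (single_le_sum (fun i _ => Nat.zero_le (a i)) (mem_univ v)).trans ha
  have hrec : ∀ z : ι → ℝ, (∑ w, z w ^ a v) * ∑ σ : Equiv.Perm ι, ∏ u, z (σ u) ^ a' u =
      ∑ w with a' w ≠ 0, ∑ σ : Equiv.Perm ι, ∏ u, z (σ u) ^ (a' + Pi.single w (a v) : ι → ℕ) u +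
      #{w | a' w = 0} * ∑ σ : Equiv.Perm ι, ∏ u, z (σ u) ^ a u := fun z => by
    rw [powerSum_mul_sum_perm, ← sum_filter_add_sum_filter_not univ (fun w => a' w ≠ 0)]
    congr 1
    simp only [not_not]
    rw [sum_congr rfl fun w hw => hswap z w (mem_filter.1 hw).2, sum_const, nsmul_eq_mul]
  have hpos : (#{w | a' w = 0} : ℝ) ≠ 0 := by
    rw [Nat.cast_ne_zero, card_ne_zero]
    exact ⟨v, by simp [ha']⟩
  have hx := hrec x
  have hy := hrec y
  rw [h _ hlt, ih _ hcard a' hle rfl, hy] at hx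
  have hmerge : ∀ w ∈ ({w | a' w ≠ 0} : Finset ι),
      ∑ σ : Equiv.Perm ι, ∏ u, x (σ u) ^ (a' + Pi.single w (a v) : ι → ℕ) u =
        ∑ σ : Equiv.Perm ι, ∏ u, y (σ u) ^ (a' + Pi.single w (a v) : ι → ℕ) u := fun w hw => by
    refine ih _ ?_ _ ((hsum w).trans_le ha) rfl
    refine lt_of_le_of_lt (card_le_card fun u hu => ?_) hcard
    by_cases huw : u = w
    · rwa [huw]
    · simpa [huw] using hu
  rw [sum_congr rfl hmerge] at hx
  exact (mul_left_cancel₀ hpos (add_left_cancel hx)).symm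

end PermutationSums

theorem IsDist.sum_prod_eq_one {X : Type*} [Fintype X] {p : X → ℝ} (hp : IsDist p) (n : ℕ) :
    ∑ s : Fin n → X, ∏ i, p (s i) = 1 := by
  rw [← Fintype.prod_sum fun (_ : Fin n) z => p z]
  simp [hp.2]

/-- The distribution on `K` equally likely blocks whose conditional distribution on block `b` is
`x` permuted by `σ b`. -/
noncomputable def blockDist {ι : Type*} {K : ℕ} (x : ι → ℝ) (σ : Fin K → Equiv.Perm ι) :
    Fin K × ι → ℝ :=
  fun z => x (σ z.1 z.2) / K

section BlockDist

variable {ι : Type*} [Fintype ι] {K n d : ℕ} {x y : ι → ℝ}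

theorem sum_blockDist_comp (φ : ℝ → ℝ) (x : ι → ℝ) (σ : Fin K → Equiv.Perm ι) :
    ∑ z, φ (blockDist x σ z) = K * ∑ v, φ (x v / K) := by
  have h : ∀ b, ∑ v, φ (x (σ b v) / K) = ∑ v, φ (x v / K) := fun b =>
    Equiv.sum_comp (σ b) fun v => φ (x v / K)
  simp [Fintype.sum_prod_type, blockDist, h]

theorem isDist_blockDist (hK : 0 < K) (hx : IsDist x) (σ : Fin K → Equiv.Perm ι) :
    IsDist (blockDist x σ) := by
  refine ⟨fun z => div_nonneg (hx.1 _) (Nat.cast_nonneg _), ?_⟩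
  have hK' : (K : ℝ) ≠ 0 := by positivity
  have := sum_blockDist_comp id x σ
  simp only [id] at this
  rw [this, ← sum_div, hx.2]
  field_simp

theorem renyiEntropy_blockDist {α : ℝ} (hα : α ≠ 1) (hK : 0 < K) (hx : ∀ v, 0 ≤ x v)
    (hpos : 0 < ∑ v, x v ^ α) (σ : Fin K → Equiv.Perm ι) :
    renyiEntropy α (blockDist x σ) = Real.log K + renyiEntropy α x := by
  have hK' : (0 : ℝ) < K := by positivity
  have hα' : 1 - α ≠ 0 := sub_ne_zero.2 hα.symm
  have hsum : ∑ z, blockDist x σ z ^ α = (K : ℝ) ^ (1 - α) * ∑ v, x v ^ α := by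
    rw [sum_blockDist_comp (fun t => t ^ α)]
    simp only [Real.div_rpow (hx _) hK'.le]
    rw [← sum_div, Real.rpow_sub hK', Real.rpow_one]
    ring
  rw [renyiEntropy, renyiEntropy, hsum,
    Real.log_mul (Real.rpow_pos_of_pos hK' _).ne' hpos.ne', Real.log_rpow hK']
  field_simp

/-- Some block receives more than `d` of the samples. -/
def Crowded (d : ℕ) (s : Fin n → Fin K × ι) : Prop :=
  ∃ b, d < #{i | (s i).1 = b}

theorem sum_prod_blockDist_of_forall_mem (hK : 0 < K) (hx : IsDist x)
    (σ : Fin K → Equiv.Perm ι) (T : Finset (Fin n)) (b : Fin K) :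
    ∑ s : Fin n → Fin K × ι,
      (if ∀ i ∈ T, (s i).1 = b then ∏ i, blockDist x σ (s i) else 0) = ((K : ℝ)⁻¹) ^ #T := by
  classical
  have hprod : ∀ s : Fin n → Fin K × ι,
      (if ∀ i ∈ T, (s i).1 = b then ∏ i, blockDist x σ (s i) else 0) =
        ∏ i, if i ∈ T → (s i).1 = b then blockDist x σ (s i) else 0 := fun s => by
    split_ifs with h
    · exact prod_congr rfl fun i _ => (if_pos (h i)).symm
    · push Not at h
      obtain ⟨i, hi, hib⟩ := h
      exact (prod_eq_zero (mem_univ i) (if_neg (by simp [hi, hib]))).symm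
  have hblock : ∑ z : Fin K × ι, (if z.1 = b then blockDist x σ z else 0) = (K : ℝ)⁻¹ := by
    have : ∑ v, x (σ b v) = 1 := (Equiv.sum_comp (σ b) x).trans hx.2
    simp only [Fintype.sum_prod_type, sum_ite_irrel, sum_const_zero, sum_ite_eq', mem_univ,
      if_true, blockDist]
    rw [← sum_div, this, one_div]
  simp only [hprod]
  rw [← Fintype.prod_sum fun i z => if i ∈ T → z.1 = b then blockDist x σ z else 0]
  have : ∀ i, (∑ z : Fin K × ι, if i ∈ T → z.1 = b then blockDist x σ z else 0) =
      if i ∈ T then (K : ℝ)⁻¹ else 1 := fun i => by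
    by_cases hi : i ∈ T
    · simpa [hi] using hblock
    · simpa [hi] using (isDist_blockDist hK hx σ).2
  simp [this, prod_ite_mem]

open Classical in
theorem sum_prod_blockDist_crowded_le (hK : 0 < K) (hx : IsDist x) (σ : Fin K → Equiv.Perm ι) :
    ∑ s : Fin n → Fin K × ι, (if Crowded d s then ∏ i, blockDist x σ (s i) else 0) ≤
      (n : ℝ) ^ (d + 1) / (K : ℝ) ^ d := by
  have hK' : (0 : ℝ) < K := by positivity
  have hnn : ∀ s : Fin n → Fin K × ι, 0 ≤ ∏ i, blockDist x σ (s i) := fun s =>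
    prod_nonneg fun i _ => (isDist_blockDist hK hx σ).1 _
  have hunion : ∀ s : Fin n → Fin K × ι,
      (if Crowded d s then ∏ i, blockDist x σ (s i) else 0) ≤
        ∑ T ∈ powersetCard (d + 1) univ, ∑ b,
          if ∀ i ∈ T, (s i).1 = b then ∏ i, blockDist x σ (s i) else 0 := fun s => by
    have hterm : ∀ (T : Finset (Fin n)) (b : Fin K),
        0 ≤ if ∀ i ∈ T, (s i).1 = b then ∏ i, blockDist x σ (s i) else 0 := fun T b => by
      split_ifs
      exacts [hnn s, le_rfl]
    split_ifs with h
    · obtain ⟨b, hb⟩ := h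
      obtain ⟨T, hT, hTc⟩ := exists_subset_card_eq (Nat.succ_le_of_lt hb)
      have hTb : ∀ i ∈ T, (s i).1 = b := fun i hi => (mem_filter.1 (hT hi)).2
      calc ∏ i, blockDist x σ (s i)
          = if ∀ i ∈ T, (s i).1 = b then ∏ i, blockDist x σ (s i) else 0 := (if_pos hTb).symm
        _ ≤ ∑ b, if ∀ i ∈ T, (s i).1 = b then ∏ i, blockDist x σ (s i) else 0 :=
            single_le_sum (f := fun b => if ∀ i ∈ T, (s i).1 = b then
              ∏ i, blockDist x σ (s i) else 0) (fun b _ => hterm T b) (mem_univ b)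
        _ ≤ _ := single_le_sum (f := fun T => ∑ b, if ∀ i ∈ T, (s i).1 = b then
              ∏ i, blockDist x σ (s i) else 0) (fun T _ => sum_nonneg fun b _ => hterm T b)
              (mem_powersetCard_univ.2 hTc)
    · exact sum_nonneg fun T _ => sum_nonneg fun b _ => hterm T b
  refine (sum_le_sum fun s _ => hunion s).trans ?_
  rw [sum_comm]
  have hT : ∀ T ∈ powersetCard (d + 1) (univ : Finset (Fin n)),
      ∑ s : Fin n → Fin K × ι, ∑ b, (if ∀ i ∈ T, (s i).1 = b then
        ∏ i, blockDist x σ (s i) else 0) = ((K : ℝ) ^ d)⁻¹ := fun T hT => by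
    rw [sum_comm]
    simp only [sum_prod_blockDist_of_forall_mem hK hx, mem_powersetCard_univ.1 hT, sum_const,
      card_univ, Fintype.card_fin, nsmul_eq_mul]
    rw [pow_succ, inv_pow]
    field_simp
  rw [sum_congr rfl hT, sum_const, card_powersetCard, card_univ, Fintype.card_fin, nsmul_eq_mul,
    ← div_eq_mul_inv]
  gcongr
  exact_mod_cast Nat.choose_le_pow n (d + 1)

/-- Off the crowded sample sequences, the two mixtures of block distributions coincide. -/
theorem sum_prod_blockDist_eq [DecidableEq ι] (h : ∀ t ≤ d, ∑ i, x i ^ t = ∑ i, y i ^ t)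
    (s : Fin n → Fin K × ι) (hs : ¬ Crowded d s) :
    ∑ σ : Fin K → Equiv.Perm ι, ∏ i, blockDist x σ (s i) =
      ∑ σ : Fin K → Equiv.Perm ι, ∏ i, blockDist y σ (s i) := by
  have hfactor : ∀ z : ι → ℝ, ∑ σ : Fin K → Equiv.Perm ι, ∏ i, blockDist z σ (s i) =
      (∏ b, ∑ τ : Equiv.Perm ι, ∏ v, z (τ v) ^ #{i | s i = (b, v)}) / (K : ℝ) ^ n := fun z => by
    rw [Fintype.prod_sum, sum_div]
    refine sum_congr rfl fun σ _ => ?_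
    simp only [blockDist, prod_div_distrib, prod_const, card_univ, Fintype.card_fin]
    congr 1
    rw [← Finset.prod_fiberwise' univ s fun w => z (σ w.1 w.2), Fintype.prod_prod_type]
    simp only [prod_const]
  rw [hfactor, hfactor]
  congr 1
  refine prod_congr rfl fun b _ => sum_perm_prod_pow_eq x y d h _ ?_
  rw [Crowded] at hs
  push Not at hs
  refine le_of_eq_of_le ?_ (hs b)
  rw [card_eq_sum_card_fiberwise (f := fun i => (s i).2) (t := univ) (fun _ _ => by simp)]
  refine sum_congr rfl fun v _ => ?_
  congr 1
  ext i
  simp [Prod.ext_iff]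

/-- Two-point bound: no estimator separates the entropies of the two families. -/
theorem exists_block_probEvent_ge {α δ ε : ℝ} (hα : α ≠ 1) (hK : 0 < K)
    (hx : IsDist x) (hy : IsDist y) (hx0 : 0 < ∑ v, x v ^ α) (hy0 : 0 < ∑ v, y v ^ α)
    (h : ∀ t ≤ d, ∑ i, x i ^ t = ∑ i, y i ^ t)
    (hδ : 2 * δ < |renyiEntropy α x - renyiEntropy α y|)
    (hn : (n : ℝ) ^ (d + 1) / (K : ℝ) ^ d ≤ 1 - 2 * ε) (f : (Fin n → Fin K × ι) → ℝ) :
    ∃ p : Fin K × ι → ℝ, IsDist p ∧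
      ε ≤ probEvent p (fun s => δ < |renyiEntropy α p - f s|) := by
  classical
  by_contra! hcon
  have hX := fun σ => hcon _ (isDist_blockDist hK hx σ)
  have hY := fun σ => hcon _ (isDist_blockDist hK hy σ)
  simp only [renyiEntropy_blockDist hα hK hx.1 hx0, probEvent] at hX
  simp only [renyiEntropy_blockDist hα hK hy.1 hy0, probEvent] at hY
  set u := Real.log K + renyiEntropy α x
  set w := Real.log K + renyiEntropy α y
  have hsep : ∀ t, δ < |u - t| ∨ δ < |w - t| := fun t => by
    by_contra! hc
    have h1 : |u - w| ≤ |u - t| + |w - t| := by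
      rw [abs_sub_comm w t]; exact abs_sub_le u t w
    have h2 : u - w = renyiEntropy α x - renyiEntropy α y := by simp only [u, w]; ring
    rw [← h2] at hδ
    linarith [hc.1, hc.2]
  set M : ℝ := ∑ σ : Fin K → Equiv.Perm ι, (1 : ℝ) with hM
  have hX' := sum_lt_sum_of_nonempty (univ_nonempty (α := Fin K → Equiv.Perm ι))
    fun σ _ => hX σ
  have hY' := sum_lt_sum_of_nonempty (univ_nonempty (α := Fin K → Equiv.Perm ι))
    fun σ _ => hY σ
  have hC := sum_le_sum fun (σ : Fin K → Equiv.Perm ι) (_ : σ ∈ univ) =>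
    sum_prod_blockDist_crowded_le (n := n) (d := d) hK hx σ
  have hT : ∑ σ : Fin K → Equiv.Perm ι, ∑ s : Fin n → Fin K × ι, ∏ i, blockDist x σ (s i) = M :=
    sum_congr rfl fun σ _ => (isDist_blockDist hK hx σ).sum_prod_eq_one n
  have hnnx : ∀ s : Fin n → Fin K × ι, 0 ≤ ∑ σ : Fin K → Equiv.Perm ι,
      ∏ i, blockDist x σ (s i) := fun s =>
    sum_nonneg fun σ _ => prod_nonneg fun i _ => (isDist_blockDist hK hx σ).1 _
  have hnny : ∀ s : Fin n → Fin K × ι, 0 ≤ ∑ σ : Fin K → Equiv.Perm ι,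
      ∏ i, blockDist y σ (s i) := fun s =>
    sum_nonneg fun σ _ => prod_nonneg fun i _ => (isDist_blockDist hK hy σ).1 _
  rw [sum_comm] at hX' hY' hC hT
  simp only [sum_ite_irrel, sum_const_zero] at hX' hY' hC
  have hpt : ∀ s : Fin n → Fin K × ι,
      (∑ σ : Fin K → Equiv.Perm ι, ∏ i, blockDist x σ (s i)) ≤
        ((if δ < |u - f s| then ∑ σ : Fin K → Equiv.Perm ι, ∏ i, blockDist x σ (s i) else 0) +
        (if δ < |w - f s| then ∑ σ : Fin K → Equiv.Perm ι, ∏ i, blockDist y σ (s i) else 0)) +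
        (if Crowded d s then ∑ σ : Fin K → Equiv.Perm ι, ∏ i, blockDist x σ (s i) else 0) :=
      fun s => by
    have h1 := hnnx s
    have h2 := hnny s
    by_cases hs : Crowded d s
    · rw [if_pos hs]
      split_ifs <;> linarith
    · rw [← sum_prod_blockDist_eq h s hs] at h2 ⊢
      rcases hsep (f s) with h3 | h3
      · rw [if_pos h3]; split_ifs <;> linarith
      · rw [if_pos h3]; split_ifs <;> linarith
  have hall := sum_le_sum fun (s : Fin n → Fin K × ι) (_ : s ∈ univ) => hpt s
  rw [sum_add_distrib, sum_add_distrib, hT] at hall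
  have hsumc : ∀ r : ℝ, ∑ _σ : Fin K → Equiv.Perm ι, r = M * r := fun r => by
    rw [hM, sum_mul, one_mul]
  rw [hsumc] at hX' hY' hC
  have hM0 : 0 ≤ M := sum_nonneg fun _ _ => zero_le_one
  have := mul_le_mul_of_nonneg_left hn hM0
  linarith

end BlockDist

section Extend

variable {X Y : Type*} [Fintype X] [Fintype Y] (e : X ↪ Y) (p : X → ℝ)

theorem sum_extend_comp (φ : ℝ → ℝ) (hφ : φ 0 = 0) :
    ∑ z, φ (Function.extend e p 0 z) = ∑ z, φ (p z) := by
  refine (Fintype.sum_of_injective e e.injective _ _ (fun z hz => ?_) fun z => ?_).symm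
  · rw [Function.extend_apply' _ _ _ hz, Pi.zero_apply, hφ]
  · rw [e.injective.extend_apply]

variable {p} in
theorem IsDist.extend (hp : IsDist p) : IsDist (Function.extend e p 0) := by
  refine ⟨fun z => ?_, (sum_extend_comp e p id rfl).trans hp.2⟩
  by_cases hz : ∃ a, e a = z
  · obtain ⟨a, rfl⟩ := hz
    rw [e.injective.extend_apply]
    exact hp.1 a
  · rw [Function.extend_apply' _ _ _ hz, Pi.zero_apply]

theorem renyiEntropy_extend {α : ℝ} (hα : α ≠ 0) :
    renyiEntropy α (Function.extend e p 0) = renyiEntropy α p := by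
  rw [renyiEntropy, renyiEntropy, sum_extend_comp e p (fun t => t ^ α) (Real.zero_rpow hα)]

theorem probEvent_extend {n : ℕ} (E : (Fin n → Y) → Prop) :
    probEvent (Function.extend e p 0) E = probEvent p fun s => E (e ∘ s) := by
  classical
  refine (Fintype.sum_of_injective (fun s : Fin n → X => e ∘ s)
    (fun s t h => e.injective.comp_left h) _ _ (fun s hs => ?_) fun s => ?_).symm
  · have : ∃ i, s i ∉ Set.range e := by
      by_contra! hc
      choose g hg using hc
      exact hs ⟨g, funext hg⟩
    obtain ⟨i, hi⟩ := this
    rw [prod_eq_zero (mem_univ i) (by rw [Function.extend_apply' _ _ _ hi, Pi.zero_apply]),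
      ite_self]
  · simp only [Function.comp_apply, e.injective.extend_apply]

end Extend

theorem pow_div_pow_le_of_le_mul_rpow {η c : ℝ} {d m k n : ℕ} (hd : 1 ≤ η * (d + 1))
    (hm : 0 < m) (hc0 : 0 < c) (hc1 : c ≤ 1) (hmk : m ≤ k)
    (hn : (n : ℝ) ≤ c * (k : ℝ) ^ (1 - η)) :
    (n : ℝ) ^ (d + 1) / ((k / m : ℕ) : ℝ) ^ d ≤ c * (2 * m) ^ d := by
  have hk1 : (1 : ℝ) ≤ k := by exact_mod_cast hm.trans_le hmk
  have hk0 : (0 : ℝ) < k := by linarith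
  have hm0 : (0 : ℝ) < m := by exact_mod_cast hm
  have hK : (k : ℝ) / (2 * m) ≤ ((k / m : ℕ) : ℝ) := by
    rw [div_le_iff₀ (by positivity)]
    have h1 := Nat.div_add_mod k m
    have h2 := Nat.mod_lt k hm
    have h3 : m * 1 ≤ m * (k / m) := Nat.mul_le_mul_left m (Nat.div_pos hmk hm)
    have h4 : k ≤ (k / m) * (2 * m) := by nlinarith
    exact_mod_cast h4
  have hK0 : (0 : ℝ) < k / (2 * m) := by positivity
  have hpow : ((k : ℝ) ^ (1 - η)) ^ (d + 1) ≤ (k : ℝ) ^ d := by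
    rw [← Real.rpow_natCast, ← Real.rpow_natCast, ← Real.rpow_mul hk0.le]
    refine Real.rpow_le_rpow_of_exponent_le hk1 ?_
    push_cast
    linarith
  calc (n : ℝ) ^ (d + 1) / ((k / m : ℕ) : ℝ) ^ d
      ≤ (c * (k : ℝ) ^ (1 - η)) ^ (d + 1) / ((k : ℝ) / (2 * m)) ^ d := by gcongr
    _ ≤ (c * (k : ℝ) ^ d) / ((k : ℝ) / (2 * m)) ^ d := by
        rw [mul_pow]
        gcongr
        exact pow_le_of_le_one hc0.le hc1 (Nat.succ_ne_zero d)
    _ = c * (2 * m) ^ d := by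
        rw [div_pow]
        field_simp

/-- **Lower bound for noninteger `α > 1`.**  For every noninteger real `α > 1` and every
`0 < ε < 1/2` and `η > 0`, there exist `δ > 0` and `c > 0` such that for all sufficiently
large `k`: any estimator using `n ≤ c k^{1-η}` samples fails, on some distribution over
`k` symbols, to estimate the order-`α` Rényi entropy to within `δ` with probability at
least `ε`.  Thus `S_α(k)` grows polynomially in `k` with exponent at least `1 - η` for
every `η > 0`. -/
theorem renyi_lower_bound_noninteger (α : ℝ) (hα : 1 < α) (hα' : ∀ m : ℕ, α ≠ m)
    (ε : ℝ) (hε0 : 0 < ε) (hε1 : ε < 1 / 2) :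
    ∀ η > (0 : ℝ), ∃ δ > (0 : ℝ), ∃ c > (0 : ℝ), ∃ K : ℕ, ∀ k : ℕ, K ≤ k →
      ∀ n : ℕ, (n : ℝ) ≤ c * (k : ℝ) ^ (1 - η) →
        ∀ f : (Fin n → Fin k) → ℝ,
          ∃ p : Fin k → ℝ, IsDist p ∧
            ε ≤ probEvent p (fun s => δ < |renyiEntropy α p - f s|) := by
  intro η hη
  obtain ⟨d, hd⟩ := exists_nat_gt (max 1 (1 / η))
  have hd1 : 1 ≤ d := by exact_mod_cast ((le_max_left _ _).trans_lt hd).le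
  have hdη : 1 ≤ η * (d + 1) := by
    have := (div_lt_iff₀ hη).1 ((le_max_right 1 (1 / η)).trans_lt hd)
    linarith
  obtain ⟨m, x, y, hm, hx0, hy0, hx1, hy1, hpow, hne⟩ := exists_isDist_powerSum_eq α hα' d hd1
  have : Nonempty (Fin m) := ⟨⟨0, hm⟩⟩
  have hxα : 0 < ∑ i, x i ^ α := sum_pos (fun i _ => Real.rpow_pos_of_pos (hx0 i) α) univ_nonempty
  have hyα : 0 < ∑ i, y i ^ α := sum_pos (fun i _ => Real.rpow_pos_of_pos (hy0 i) α) univ_nonempty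
  have hH : renyiEntropy α x - renyiEntropy α y ≠ 0 := by
    rw [renyiEntropy, renyiEntropy, ← mul_sub]
    refine mul_ne_zero (one_div_ne_zero (by linarith)) (sub_ne_zero.2 fun hlog => hne ?_)
    exact Real.log_injOn_pos hxα hyα hlog
  have hgap := abs_pos.2 hH
  have hm1 : (1 : ℝ) ≤ m := by exact_mod_cast hm
  have hP : (1 : ℝ) ≤ (2 * m) ^ d := one_le_pow₀ (by linarith)
  refine ⟨|renyiEntropy α x - renyiEntropy α y| / 3, by positivity,
    (1 - 2 * ε) / (2 * m) ^ d, div_pos (by linarith) (by positivity), m,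
    fun k hk n hn f => ?_⟩
  have hbound := pow_div_pow_le_of_le_mul_rpow hdη hm (div_pos (by linarith) (by positivity))
    ((div_le_one (by positivity)).2 (by linarith)) hk hn
  rw [div_mul_cancel₀ _ (by positivity)] at hbound
  let e : Fin (k / m) × Fin m ↪ Fin k :=
    finProdFinEquiv.toEmbedding.trans (Fin.castLEEmb (Nat.div_mul_le_self k m))
  obtain ⟨p, hp, hpε⟩ := exists_block_probEvent_ge (δ := |renyiEntropy α x - renyiEntropy α y| / 3)
    hα.ne' (Nat.div_pos hk hm) ⟨fun i => (hx0 i).le, hx1⟩ ⟨fun i => (hy0 i).le, hy1⟩ hxα hyα hpow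
    (by linarith) hbound fun s => f (e ∘ s)
  refine ⟨Function.extend e p 0, hp.extend e, ?_⟩
  rw [probEvent_extend, renyiEntropy_extend e p (by linarith)]
  exact hpε
end
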